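/- (Stability estimate (26) in Proposition 2.) Let δ > 2Ū and L_U > 0. Let U be a map assigning to each x ∈ Ω and each Borel probability measure μ on Ω a real number U(x, μ) such that 0 ≤ U(x, μ) ≤ Ū for all x and μ, and |U(x, μ) − U(x, ν)| ≤ L_U · TV(μ, ν) for all x and all Borel probability measures μ, ν on Ω. Let l₁, l₂ be Borel probability measures on Ω, and for i = 1, 2 let Φᵢ : Ω → ℝ be continuous with 0 ≤ Φᵢ ≤ Ū on Ω and satisfy Φᵢ(x) = U(x, lᵢ) + (1/(2δ)) ∫_Ω ((Φᵢ(z) − Φᵢ(x))₊)² lᵢ(dz) for every x ∈ Ω. Then sup_{x ∈ Ω} |Φ₁(x) − Φ₂(x)| ≤ (1 − 2Ū/δ)⁻¹ (L_U + Ū²/(2δ)) · TV(l₁, l₂). -/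

import Mathlib

open MeasureTheory

/-- The action space `Ω = [0,1] ⊆ ℝ` with its Borel σ-algebra. -/
abbrev Ω : Type := Set.Icc (0:ℝ) 1

/-- Total variation distance between two (finite) Borel measures on `Ω`:
the total mass of the total variation of `μ − ν`, expressed via the Jordan
decomposition as `(μ − ν)(Ω) + (ν − μ)(Ω)` (truncated measure subtraction). -/
noncomputable def TV (μ ν : Measure Ω) : ℝ :=
  ((μ - ν) Set.univ + (ν - μ) Set.univ).toReal

theorem TV_aux (μ ν : Measure Ω) [IsProbabilityMeasure μ] [IsProbabilityMeasure ν]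
    (g : Ω → ℝ) (hg : Continuous g) (C : ℝ) (h0 : ∀ x, 0 ≤ g x) (hC : ∀ x, g x ≤ C) :
    ∫ z, g z ∂μ ≤ ∫ z, g z ∂ν + C * TV μ ν := by
  have hint : ∀ (m : Measure Ω) [IsFiniteMeasure m], Integrable g m := fun m _ =>
    Integrable.of_bound hg.aestronglyMeasurable C
      (Filter.Eventually.of_forall fun x => by
        rw [Real.norm_eq_abs, abs_of_nonneg (h0 x)]; exact hC x)
  have hle : μ ≤ (μ - ν) + ν := Measure.sub_le_iff_le_add.1 le_rfl
  have h1 : ∫ z, g z ∂μ ≤ ∫ z, g z ∂((μ - ν) + ν) :=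
    integral_mono_measure hle (Filter.Eventually.of_forall h0) (hint _)
  rw [integral_add_measure (hint _) (hint _)] at h1
  have h2 : ∫ z, g z ∂(μ - ν) ≤ ∫ z, C ∂(μ - ν) :=
    integral_mono (hint _) (integrable_const _) hC
  rw [integral_const, smul_eq_mul] at h2
  have hC0 : 0 ≤ C := (h0 0).trans (hC 0)
  have h3 : (μ - ν).real Set.univ ≤ TV μ ν := by
    unfold TV Measure.real
    exact ENNReal.toReal_mono (by finiteness) le_self_add
  nlinarith

theorem TV_symm (μ ν : Measure Ω) : TV μ ν = TV ν μ := by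
  unfold TV; rw [add_comm]

/-- One-sided pointwise estimate. -/
theorem one_side
    (Ubar LU : ℝ) (hUbar : 0 < Ubar)
    (δ : ℝ) (hδ : 2 * Ubar < δ)
    (U : Ω → Measure Ω → ℝ)
    (hUL : ∀ (x : Ω) (μ ν : Measure Ω), IsProbabilityMeasure μ →
      IsProbabilityMeasure ν → |U x μ - U x ν| ≤ LU * TV μ ν)
    (l₁ l₂ : Measure Ω) [IsProbabilityMeasure l₁] [IsProbabilityMeasure l₂]
    (Φ₁ Φ₂ : Ω → ℝ) (hc₁ : Continuous Φ₁) (hc₂ : Continuous Φ₂)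
    (hb₁ : ∀ x, 0 ≤ Φ₁ x ∧ Φ₁ x ≤ Ubar) (hb₂ : ∀ x, 0 ≤ Φ₂ x ∧ Φ₂ x ≤ Ubar)
    (hfix₁ : ∀ x, Φ₁ x = U x l₁ + (1 / (2 * δ)) * ∫ z, (max (Φ₁ z - Φ₁ x) 0) ^ 2 ∂l₁)
    (hfix₂ : ∀ x, Φ₂ x = U x l₂ + (1 / (2 * δ)) * ∫ z, (max (Φ₂ z - Φ₂ x) 0) ^ 2 ∂l₂)
    (D : ℝ) (hD : ∀ x, |Φ₁ x - Φ₂ x| ≤ D) (x : Ω) :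
    Φ₁ x - Φ₂ x ≤ 2 * Ubar / δ * D + (LU + Ubar ^ 2 / (2 * δ)) * TV l₁ l₂ := by
  have hδ0 : 0 < δ := by linarith
  have hm : ∀ Φ : Ω → ℝ, (∀ x, 0 ≤ Φ x ∧ Φ x ≤ Ubar) → ∀ z,
      0 ≤ max (Φ z - Φ x) 0 ∧ max (Φ z - Φ x) 0 ≤ Ubar := fun Φ h z =>
    ⟨le_max_right _ _, max_le (by linarith [h z, h x, (h z).2, (h x).1]) hUbar.le⟩
  have hcont : ∀ Φ : Ω → ℝ, Continuous Φ → Continuous fun z => (max (Φ z - Φ x) 0) ^ 2 :=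
    fun Φ h => by fun_prop
  have hA := TV_aux l₁ l₂ (fun z => (max (Φ₁ z - Φ₁ x) 0) ^ 2) (hcont _ hc₁) (Ubar ^ 2)
    (fun z => sq_nonneg _) (fun z => pow_le_pow_left₀ (hm _ hb₁ z).1 (hm _ hb₁ z).2 2)
  have hint : ∀ Φ : Ω → ℝ, Continuous Φ → Integrable (fun z => (max (Φ z - Φ x) 0) ^ 2) l₂ :=
    fun Φ h => (hcont Φ h).integrable_of_hasCompactSupport (HasCompactSupport.of_compactSpace _)
  have hB : ∫ z, (max (Φ₁ z - Φ₁ x) 0) ^ 2 ∂l₂ ≤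
      ∫ z, ((max (Φ₂ z - Φ₂ x) 0) ^ 2 + 4 * Ubar * D) ∂l₂ := by
    refine integral_mono (hint _ hc₁) ((hint _ hc₂).add (integrable_const _)) fun z => ?_
    have h1 := hm _ hb₁ z
    have h2 := hm _ hb₂ z
    have h3 : max (Φ₁ z - Φ₁ x) 0 ≤ max (Φ₂ z - Φ₂ x) 0 + 2 * D := by
      have a1 := abs_le.1 (hD z)
      have a2 := abs_le.1 (hD x)
      refine max_le ?_ ?_
      · linarith [le_max_left (Φ₂ z - Φ₂ x) 0, a1.2, a2.1]
      · linarith [h2.1, (abs_nonneg _).trans (hD x)]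
    have hD0 := (abs_nonneg _).trans (hD x)
    show (max (Φ₁ z - Φ₁ x) 0) ^ 2 ≤ (max (Φ₂ z - Φ₂ x) 0) ^ 2 + 4 * Ubar * D
    generalize max (Φ₁ z - Φ₁ x) 0 = a at *
    generalize max (Φ₂ z - Φ₂ x) 0 = b at *
    have s0 : 0 ≤ a + b := by linarith
    have s1 : (a - b) * (a + b) ≤ 2 * D * (a + b) :=
      mul_le_mul_of_nonneg_right (by linarith) s0
    have s2 : 2 * D * (a + b) ≤ 2 * D * (2 * Ubar) :=
      mul_le_mul_of_nonneg_left (by linarith) (by linarith)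
    nlinarith
  rw [integral_add (hint _ hc₂) (integrable_const _), integral_const] at hB
  simp only [probReal_univ, one_smul] at hB
  have hu := (abs_le.1 (hUL x l₁ l₂ inferInstance inferInstance)).2
  have hk : 0 ≤ 1 / (2 * δ) := by positivity
  have hfin := mul_le_mul_of_nonneg_left (hA.trans (add_le_add_left hB _)) hk
  have e : 1 / (2 * δ) * (4 * Ubar * D + Ubar ^ 2 * TV l₁ l₂) =
     2 * Ubar / δ * D + Ubar ^ 2 / (2 * δ) * TV l₁ l₂ := by field_simp; ring
  rw [hfix₁ x, hfix₂ x]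
  linarith

/-- **Stability estimate (26) in Proposition 2.** -/
theorem stmt2
    (Ubar LU : ℝ) (hUbar : 0 < Ubar) (hLU : 0 < LU)
    (δ : ℝ) (hδ : 2 * Ubar < δ)
    (U : Ω → Measure Ω → ℝ)
    (hUb : ∀ (x : Ω) (μ : Measure Ω), IsProbabilityMeasure μ →
      0 ≤ U x μ ∧ U x μ ≤ Ubar)
    (hUL : ∀ (x : Ω) (μ ν : Measure Ω), IsProbabilityMeasure μ →
      IsProbabilityMeasure ν → |U x μ - U x ν| ≤ LU * TV μ ν)
    (l₁ l₂ : Measure Ω) [IsProbabilityMeasure l₁] [IsProbabilityMeasure l₂]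
    (Φ₁ Φ₂ : Ω → ℝ) (hc₁ : Continuous Φ₁) (hc₂ : Continuous Φ₂)
    (hb₁ : ∀ x, 0 ≤ Φ₁ x ∧ Φ₁ x ≤ Ubar) (hb₂ : ∀ x, 0 ≤ Φ₂ x ∧ Φ₂ x ≤ Ubar)
    (hfix₁ : ∀ x, Φ₁ x = U x l₁ + (1 / (2 * δ)) * ∫ z, (max (Φ₁ z - Φ₁ x) 0) ^ 2 ∂l₁)
    (hfix₂ : ∀ x, Φ₂ x = U x l₂ + (1 / (2 * δ)) * ∫ z, (max (Φ₂ z - Φ₂ x) 0) ^ 2 ∂l₂) :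
    ⨆ x : Ω, |Φ₁ x - Φ₂ x| ≤
      (1 - 2 * Ubar / δ)⁻¹ * (LU + Ubar ^ 2 / (2 * δ)) * TV l₁ l₂ := by
  have hδ0 : 0 < δ := by linarith
  have hbdd : BddAbove (Set.range fun x : Ω => |Φ₁ x - Φ₂ x|) :=
    ⟨Ubar, by
      rintro _ ⟨x, rfl⟩
      exact abs_le.2 ⟨by linarith [(hb₁ x).1, (hb₂ x).2], by linarith [(hb₁ x).2, (hb₂ x).1]⟩⟩
  have hD : ∀ x, |Φ₁ x - Φ₂ x| ≤ ⨆ x : Ω, |Φ₁ x - Φ₂ x| := fun x => le_ciSup hbdd x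
  set D := ⨆ x : Ω, |Φ₁ x - Φ₂ x| with hDdef
  have key : D ≤ 2 * Ubar / δ * D + (LU + Ubar ^ 2 / (2 * δ)) * TV l₁ l₂ := by
    conv_lhs => rw [hDdef]
    refine ciSup_le fun x => abs_sub_le_iff.2 ⟨?_, ?_⟩
    · exact one_side Ubar LU hUbar δ hδ U hUL l₁ l₂ Φ₁ Φ₂ hc₁ hc₂ hb₁ hb₂ hfix₁ hfix₂ D hD x
    · rw [TV_symm]
      exact one_side Ubar LU hUbar δ hδ U hUL l₂ l₁ Φ₂ Φ₁ hc₂ hc₁ hb₂ hb₁ hfix₂ hfix₁ D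
        (fun x => by rw [abs_sub_comm]; exact hD x) x
  have hpos : 0 < 1 - 2 * Ubar / δ := by
    rw [sub_pos, div_lt_one hδ0]; exact hδ
  rw [mul_assoc, inv_mul_eq_div, le_div_iff₀ hpos]
  linarith
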